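/- Let u, v : ℝ² → ℂ be continuously differentiable and let κ ∈ ℂ∖{0}. Suppose Ψ : ℝ² → M₂(ℂ) is differentiable and satisfies the k-Lax pair with parameter κ: ∂_x Ψ − (i/4)(κ⁻¹−κ)[σ₃,Ψ] = U(x,t,κ)Ψ and ∂_t Ψ − (i/4)(κ⁻¹+κ)[σ₃,Ψ] = V(x,t,κ)Ψ. Define G(x,t) := [[ū(x,t), −1],[κ̄ + |u(x,t)|², −u(x,t)]] and the constant matrix C := κ̄⁻¹[[0,1],[−κ̄,0]]. Then Θ(x,t) := G(x,t) · conj(Ψ(x,t)) · C (entrywise complex conjugation of Ψ) satisfies the k-Lax pair with parameter κ̄: ∂_x Θ − (i/4)(κ̄⁻¹−κ̄)[σ₃,Θ] = U(x,t,κ̄)Θ and ∂_t Θ − (i/4)(κ̄⁻¹+κ̄)[σ₃,Θ] = V(x,t,κ̄)Θ. -/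

import Mathlib

open Complex Matrix

noncomputable section

abbrev M2 : Type := Matrix (Fin 2) (Fin 2) ℂ

/-- partial derivative in `x` (first coordinate). -/
def pdx (f : ℝ × ℝ → ℂ) (p : ℝ × ℝ) : ℂ := fderiv ℝ f p (1, 0)

/-- partial derivative in `t` (second coordinate). -/
def pdt (f : ℝ × ℝ → ℂ) (p : ℝ × ℝ) : ℂ := fderiv ℝ f p (0, 1)

/-- entrywise partial derivative in `x` of a matrix-valued function. -/
def Mdx (M : ℝ × ℝ → M2) (p : ℝ × ℝ) : M2 := Matrix.of fun i j => pdx (fun q => M q i j) p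

/-- entrywise partial derivative in `t` of a matrix-valued function. -/
def Mdt (M : ℝ × ℝ → M2) (p : ℝ × ℝ) : M2 := Matrix.of fun i j => pdt (fun q => M q i j) p

def sigma3 : M2 := !![1, 0; 0, -1]

/-- matrix commutator. -/
def mcomm (A B : M2) : M2 := A * B - B * A

/-- `|w|²` as a complex number. -/
def nsq (w : ℂ) : ℂ := (Complex.normSq w : ℂ)

/-- complex conjugation. -/
def cj (w : ℂ) : ℂ := (starRingEnd ℂ) w

/-- the massive Thirring system. -/
def MTsys (u v : ℝ × ℝ → ℂ) : Prop :=
  ∀ p : ℝ × ℝ,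
    Complex.I * (pdt u p + pdx u p) + v p + nsq (v p) * u p = 0 ∧
    Complex.I * (pdt v p - pdx v p) + u p + nsq (u p) * v p = 0

def U1m (u v : ℝ × ℝ → ℂ) (p : ℝ × ℝ) : M2 :=
  !![-(Complex.I/4) * (nsq (u p) + nsq (v p)), (Complex.I/2) * cj (u p);
     pdx u p - (Complex.I/2) * u p * nsq (v p) - (Complex.I/2) * v p,
     (Complex.I/4) * (nsq (u p) + nsq (v p))]

def U2m (u v : ℝ × ℝ → ℂ) (p : ℝ × ℝ) : M2 :=
  !![u p * cj (v p), -cj (v p);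
     u p + (u p)^2 * cj (v p), -(u p * cj (v p))]

def V1m (u v : ℝ × ℝ → ℂ) (p : ℝ × ℝ) : M2 :=
  !![(Complex.I/4) * (nsq (u p) - nsq (v p)), -(Complex.I/2) * cj (u p);
     pdt u p - (Complex.I/2) * u p * nsq (v p) - (Complex.I/2) * v p,
     -((Complex.I/4) * (nsq (u p) - nsq (v p)))]

/-- the matrix `U(x,t,k)` of the k-Lax pair. -/
def Umat (u v : ℝ × ℝ → ℂ) (k : ℂ) (p : ℝ × ℝ) : M2 :=
  U1m u v p + (Complex.I/(2*k)) • U2m u v p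

/-- the matrix `V(x,t,k)` of the k-Lax pair. -/
def Vmat (u v : ℝ × ℝ → ℂ) (k : ℂ) (p : ℝ × ℝ) : M2 :=
  V1m u v p + (Complex.I/(2*k)) • U2m u v p

theorem nsq_eq (w : ℂ) : nsq w = w * cj w := by
  simp [nsq, cj, Complex.mul_conj]

theorem cj_diff {f : ℝ × ℝ → ℂ} {p : ℝ × ℝ} (hf : DifferentiableAt ℝ f p) :
    DifferentiableAt ℝ (fun q => cj (f q)) p :=
  (Complex.conjCLE.toContinuousLinearMap.hasFDerivAt.comp p hf.hasFDerivAt).differentiableAt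

theorem cj_fderiv {f : ℝ × ℝ → ℂ} {p : ℝ × ℝ} (hf : DifferentiableAt ℝ f p) (w : ℝ × ℝ) :
    fderiv ℝ (fun q => cj (f q)) p w = cj (fderiv ℝ f p w) := by
  have h := (Complex.conjCLE.toContinuousLinearMap.hasFDerivAt.comp p hf.hasFDerivAt).fderiv
  have h2 : fderiv ℝ (fun q => cj (f q)) p = _ := h
  rw [h2]; rfl

/-- derivative of `(α f + β g) c`. -/
theorem entry_fderiv {a b f g : ℝ × ℝ → ℂ} {p : ℝ × ℝ} (c : ℂ)
    (ha : DifferentiableAt ℝ a p) (hb : DifferentiableAt ℝ b p)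
    (hf : DifferentiableAt ℝ f p) (hg : DifferentiableAt ℝ g p) (w : ℝ × ℝ) :
    fderiv ℝ (fun q => (a q * cj (f q) + b q * cj (g q)) * c) p w =
      (fderiv ℝ a p w * cj (f p) + a p * cj (fderiv ℝ f p w)
        + (fderiv ℝ b p w * cj (g p) + b p * cj (fderiv ℝ g p w))) * c := by
  have hf' := cj_diff hf
  have hg' := cj_diff hg
  have h := ((ha.hasFDerivAt.mul hf'.hasFDerivAt).add
    (hb.hasFDerivAt.mul hg'.hasFDerivAt)).mul_const c
  have h2 : fderiv ℝ (fun q => (a q * cj (f q) + b q * cj (g q)) * c) p = _ := h.fderiv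
  rw [h2]
  simp [cj_fderiv hf, cj_fderiv hg]
  ring

theorem theta_fderiv (u : ℝ × ℝ → ℂ) (p w : ℝ × ℝ) (hu : DifferentiableAt ℝ u p)
    (κ : ℂ) (hκ : κ ≠ 0) (Ψ : ℝ × ℝ → M2)
    (hΨ : ∀ i j, DifferentiableAt ℝ (fun p => Ψ p i j) p) (i j : Fin 2) :
    fderiv ℝ (fun q => (!![cj (u q), -1; κ + nsq (u q), -(u q)] * (Ψ q).map cj
      * (κ⁻¹ • !![0, 1; -κ, 0] : M2)) i j) p w =
    ((!![cj (fderiv ℝ u p w), 0;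
        fderiv ℝ u p w * cj (u p) + u p * cj (fderiv ℝ u p w), -(fderiv ℝ u p w)]
        * (Ψ p).map cj
      + !![cj (u p), -1; κ + nsq (u p), -(u p)]
        * (Matrix.of fun i j => fderiv ℝ (fun q => Ψ q i j) p w : M2).map cj)
      * (κ⁻¹ • !![0, 1; -κ, 0] : M2)) i j := by
  have hc := cj_diff hu
  have e2 : fderiv ℝ (fun q => κ + u q * cj (u q)) p w
      = fderiv ℝ u p w * cj (u p) + u p * cj (fderiv ℝ u p w) := by
    have h2 : fderiv ℝ (fun q => κ + u q * cj (u q)) p = _ :=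
      ((hu.hasFDerivAt.mul hc.hasFDerivAt).const_add κ).fderiv
    rw [h2]; simp [cj_fderiv hu]; ring
  have d2 : DifferentiableAt ℝ (fun q => κ + u q * cj (u q)) p := (hu.mul hc).const_add κ
  have e3 : fderiv ℝ (fun q => -u q) p w = -fderiv ℝ u p w := by
    rw [fderiv_fun_neg]; rfl
  have e4 : fderiv ℝ (fun _ : ℝ × ℝ => (-1 : ℂ)) p w = 0 := by simp
  have row0 := fun (l : Fin 2) (c : ℂ) => entry_fderiv c hc
    (differentiableAt_const (-1 : ℂ)) (hΨ 0 l) (hΨ 1 l) w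
  have row1 := fun (l : Fin 2) (c : ℂ) => entry_fderiv c d2 hu.neg (hΨ 0 l) (hΨ 1 l) w
  simp only [cj_fderiv hu, e4] at row0
  have row1' := fun (l : Fin 2) (c : ℂ) => (row1 l c)
  simp only [e2] at row1'
  have e3' : fderiv ℝ (-u) p w = -fderiv ℝ u p w := e3
  simp only [e3', Pi.neg_apply] at row1'
  obtain ⟨D, hD⟩ : ∃ D : M2, ∀ i j, fderiv ℝ (fun q => Ψ q i j) p w = D i j :=
    ⟨Matrix.of fun i j => fderiv ℝ (fun q => Ψ q i j) p w, fun _ _ => rfl⟩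
  have hDD : (Matrix.of fun i j => fderiv ℝ (fun q => Ψ q i j) p w : M2) = D :=
    Matrix.ext hD
  rw [hDD]
  simp only [hD] at row0 row1'
  clear hD hDD row1
  have gen : ∀ (a b c d k : ℂ) (P Q : M2) (i : Fin 2),
      (!![a, b; c, d] * P.map cj * (k⁻¹ • !![0, 1; -k, 0] : M2)) i 0
        = (!![a, b; c, d] i 0 * cj (P 0 1) + !![a, b; c, d] i 1 * cj (P 1 1)) * (k⁻¹ * -k) ∧
      (!![a, b; c, d] * P.map cj * (k⁻¹ • !![0, 1; -k, 0] : M2)) i 1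
        = (!![a, b; c, d] i 0 * cj (P 0 0) + !![a, b; c, d] i 1 * cj (P 1 0)) * k⁻¹ := by
    intro a b c d k P Q i
    constructor
    · rw [Matrix.mul_apply, Fin.sum_univ_two, Matrix.mul_apply, Matrix.mul_apply,
        Fin.sum_univ_two, Fin.sum_univ_two]
      simp
    · rw [Matrix.mul_apply, Fin.sum_univ_two, Matrix.mul_apply, Matrix.mul_apply,
        Fin.sum_univ_two, Fin.sum_univ_two]
      simp
  rw [Matrix.add_mul, Matrix.add_apply]
  fin_cases i <;> fin_cases j
  · have h := row0 1 (κ⁻¹ * -κ)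
    have e := fun (a b c d : ℂ) (P : M2) => (gen a b c d κ P P 0).1
    simp only [Fin.zero_eta, Fin.mk_one, e]
    refine Eq.trans h ?_
    simp
    ring
  · have h := row0 0 κ⁻¹
    have e := fun (a b c d : ℂ) (P : M2) => (gen a b c d κ P P 0).2
    simp only [Fin.zero_eta, Fin.mk_one, e]
    refine Eq.trans h ?_
    simp
    ring
  · have h := row1' 1 (κ⁻¹ * -κ)
    have e := fun (a b c d : ℂ) (P : M2) => (gen a b c d κ P P 1).1
    simp only [Fin.zero_eta, Fin.mk_one, e, nsq_eq]
    refine Eq.trans h ?_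
    simp
    ring
  · have h := row1' 0 κ⁻¹
    have e := fun (a b c d : ℂ) (P : M2) => (gen a b c d κ P P 1).2
    simp only [Fin.zero_eta, Fin.mk_one, e, nsq_eq]
    refine Eq.trans h ?_
    simp
    ring

/-- if `Ψ` solves the k-Lax pair with parameter `κ`, then
`Θ = G Ψ̄ C` (entrywise conjugation), with
`G = [[ū,-1],[κ̄+|u|²,-u]]` and `C = κ̄⁻¹ [[0,1],[-κ̄,0]]`, solves the
k-Lax pair with parameter `κ̄`. -/
theorem k_lax_symmetry
    (u v : ℝ × ℝ → ℂ) (hu : ContDiff ℝ 1 u) (hv : ContDiff ℝ 1 v)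
    (κ : ℂ) (hκ : κ ≠ 0) (Ψ : ℝ × ℝ → M2)
    (hΨ : ∀ i j, Differentiable ℝ fun p => Ψ p i j)
    (hLx : ∀ p : ℝ × ℝ,
      Mdx Ψ p - (Complex.I / 4 * (κ⁻¹ - κ)) • mcomm sigma3 (Ψ p)
        = Umat u v κ p * Ψ p)
    (hLt : ∀ p : ℝ × ℝ,
      Mdt Ψ p - (Complex.I / 4 * (κ⁻¹ + κ)) • mcomm sigma3 (Ψ p)
        = Vmat u v κ p * Ψ p) :
    let κb : ℂ := cj κ
    let G : ℝ × ℝ → M2 := fun p => !![cj (u p), -1; κb + nsq (u p), -(u p)]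
    let C : M2 := κb⁻¹ • !![0, 1; -κb, 0]
    let Θ : ℝ × ℝ → M2 := fun p => G p * (Ψ p).map cj * C
    (∀ p : ℝ × ℝ,
        Mdx Θ p - (Complex.I / 4 * (κb⁻¹ - κb)) • mcomm sigma3 (Θ p)
          = Umat u v κb p * Θ p) ∧
    (∀ p : ℝ × ℝ,
        Mdt Θ p - (Complex.I / 4 * (κb⁻¹ + κb)) • mcomm sigma3 (Θ p)
          = Vmat u v κb p * Θ p) := by
  intro κb G C Θ
  have hκb : κb ≠ 0 := by simpa [κb, cj] using hκ
  have hud : ∀ p, DifferentiableAt ℝ u p := fun p => (hu.differentiable (by norm_num)) p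
  have cadd : ∀ a b, cj (a + b) = cj a + cj b := fun a b => map_add _ a b
  have csub : ∀ a b, cj (a - b) = cj a - cj b := fun a b => map_sub _ a b
  have cmul : ∀ a b, cj (a * b) = cj a * cj b := fun a b => map_mul _ a b
  have cneg : ∀ a, cj (-a) = -cj a := fun a => map_neg _ a
  have cinv : ∀ a, cj (a⁻¹) = (cj a)⁻¹ := fun a => map_inv₀ _ a
  have cI : cj Complex.I = -Complex.I := Complex.conj_I
  have c2 : cj 2 = 2 := Complex.conj_ofNat 2
  have c4 : cj 4 = 4 := Complex.conj_ofNat 4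
  have ccj : ∀ a, cj (cj a) = a := fun a => Complex.conj_conj a
  have cpow : ∀ a (n : ℕ), cj (a ^ n) = cj a ^ n := fun a n => map_pow _ a n
  have cmap : ∀ a b c d : ℂ, (!![a, b; c, d] : M2).map cj = !![cj a, cj b; cj c, cj d] := by
    intro a b c d
    ext i j
    fin_cases i <;> fin_cases j <;> rfl
  have hκe : cj κ = κb := rfl
  have hI : Complex.I ^ 2 = -1 := Complex.I_sq
  constructor
  · intro p
    have key : Mdx Θ p = _ :=
      Matrix.ext fun i j => theta_fderiv u p (1, 0) (hud p) κb hκb Ψ (fun i j => hΨ i j p) i j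
    have h := eq_add_of_sub_eq (hLx p)
    have h' : (Matrix.of fun i j => fderiv ℝ (fun q => Ψ q i j) p (1, 0) : M2) = _ := h
    rw [key, h']
    clear key h h' hLx hLt
    clear_value κb
    change _ = Umat u v κb p * (!![cj (u p), -1; κb + nsq (u p), -(u p)] * (Ψ p).map cj
      * (κb⁻¹ • !![0, 1; -κb, 0] : M2))
    change _ - _ • mcomm sigma3 (!![cj (u p), -1; κb + nsq (u p), -(u p)] * (Ψ p).map cj
      * (κb⁻¹ • !![0, 1; -κb, 0] : M2)) = _
    have hx : fderiv ℝ u p (1, 0) = pdx u p := rfl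
    rw [hx]
    generalize Ψ p = P
    have hP := Matrix.eta_fin_two P
    generalize P 0 0 = a, P 0 1 = b, P 1 0 = c, P 1 1 = d at hP
    subst hP
    ext i j
    fin_cases i <;> fin_cases j <;>
    · simp [Matrix.mul_apply, Fin.sum_univ_two, nsq_eq, Umat, U1m, U2m, mcomm, sigma3,
        cadd, csub, cmul, cneg, cinv, cI, c2, c4, ccj, hκe, cpow, cmap, div_eq_mul_inv]
      field_simp
      ring
  · intro p
    have key : Mdt Θ p = _ :=
      Matrix.ext fun i j => theta_fderiv u p (0, 1) (hud p) κb hκb Ψ (fun i j => hΨ i j p) i j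
    have h := eq_add_of_sub_eq (hLt p)
    have h' : (Matrix.of fun i j => fderiv ℝ (fun q => Ψ q i j) p (0, 1) : M2) = _ := h
    rw [key, h']
    clear key h h' hLx hLt
    clear_value κb
    change _ = Vmat u v κb p * (!![cj (u p), -1; κb + nsq (u p), -(u p)] * (Ψ p).map cj
      * (κb⁻¹ • !![0, 1; -κb, 0] : M2))
    change _ - _ • mcomm sigma3 (!![cj (u p), -1; κb + nsq (u p), -(u p)] * (Ψ p).map cj
      * (κb⁻¹ • !![0, 1; -κb, 0] : M2)) = _
    have hx : fderiv ℝ u p (0, 1) = pdt u p := rfl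
    rw [hx]
    generalize Ψ p = P
    have hP := Matrix.eta_fin_two P
    generalize P 0 0 = a, P 0 1 = b, P 1 0 = c, P 1 1 = d at hP
    subst hP
    ext i j
    fin_cases i <;> fin_cases j <;>
    · simp [Matrix.mul_apply, Fin.sum_univ_two, nsq_eq, Vmat, V1m, U2m, mcomm, sigma3,
        cadd, csub, cmul, cneg, cinv, cI, c2, c4, ccj, hκe, cpow, cmap, div_eq_mul_inv]
      field_simp
      ring
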